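/- arXiv:1901.01959 — 2 statements merged into one kernel-verified Lean document; each statement's English description precedes it below -/
import Mathlib

section
/- Let G be a connected simple graph with toughness τ(G) = t ≤ 1, and let S be a tough-set of G. Then for any nonempty subset S′ of S, the number of connected components of G − S that contain a vertex adjacent to some vertex of S′ is at least |S′|/t. -/
open SimpleGraph

variable {V : Type*} {W : Type*}

/-- A graph is `P₄`-free if it contains no induced subgraph isomorphic to the
path on four vertices. -/
def P4Free (G : SimpleGraph V) : Prop := IsEmpty (SimpleGraph.pathGraph 4 ↪g G)

/-- `R` is (the vertex set of) a connected component of `G - S`: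
a maximal subset of `V(G) - S` inducing a connected subgraph. -/
def IsCompOf (G : SimpleGraph V) (S R : Set V) : Prop :=
  R ⊆ Sᶜ ∧ (G.induce R).Connected ∧
    ∀ R' : Set V, R ⊆ R' → R' ⊆ Sᶜ → (G.induce R').Connected → R' = R

/-- The number of connected components of `G - S`. -/
noncomputable def numComp (G : SimpleGraph V) (S : Set V) : ℕ :=
  {R : Set V | IsCompOf G S R}.ncard

/-- `S` is a cutset of `G` : the graph `G - S` is disconnected. -/
def IsCutset (G : SimpleGraph V) (S : Set V) : Prop := 2 ≤ numComp G S

/-- `G` is `t`-tough: for every cutset `S`, `t * c(G - S) ≤ |S|`. -/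
def Tough (t : ℝ) (G : SimpleGraph V) : Prop :=
  ∀ S : Set V, IsCutset G S → t * (numComp G S : ℝ) ≤ (S.ncard : ℝ)

/-- `t` is the toughness of `G` : the largest `s` such that `G` is `s`-tough.
(For a complete graph no such largest `s` exists; the toughness is infinite.) -/
def IsToughness (G : SimpleGraph V) (t : ℝ) : Prop :=
  Tough t G ∧ ∀ s : ℝ, Tough s G → s ≤ t

/-- `S` is a tough-set of `G` (whose toughness is `t`): a cutset with
`|S| = t * c(G - S)`. -/
def ToughSet (G : SimpleGraph V) (t : ℝ) (S : Set V) : Prop :=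
  IsCutset G S ∧ (S.ncard : ℝ) = t * (numComp G S : ℝ)

/-- Vertex `u` is adjacent in `G` to some vertex of the set `R`. -/
def AdjToSet (G : SimpleGraph V) (u : V) (R : Set V) : Prop := ∃ v ∈ R, G.Adj u v

/-- `G` has a Hamiltonian cycle. -/
def HasHamCycle [DecidableEq V] (G : SimpleGraph V) : Prop :=
  ∃ (v : V) (w : G.Walk v v), w.IsHamiltonianCycle

/-- `G` has a spanning `k`-walk: a closed walk visiting every vertex at least once
and at most `k` times.  (In a nontrivial closed walk the base vertex occurs one
extra time in `Walk.support`, whence the correction term.) -/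
def HasSpanningKWalk [DecidableEq V] (G : SimpleGraph V) (k : ℕ) : Prop :=
  ∃ (v : V) (w : G.Walk v v), (∀ x : V, x ∈ w.support) ∧
    ∀ x : V, w.support.count x ≤ k + (if x = v then 1 else 0)

/-- The prism over `G`: the Cartesian (box) product `G □ K₂`. -/
def prism (G : SimpleGraph V) : SimpleGraph (V × Fin 2) :=
  G.boxProd (⊤ : SimpleGraph (Fin 2))

/-- The graph obtained from `G` by contracting the set `R` to a single vertex
(namely `Sum.inr ()`), which is adjacent to exactly those vertices outside `R`
having a neighbor in `R`. -/
def contractSet (G : SimpleGraph V) (R : Set V) : SimpleGraph (↥(Rᶜ) ⊕ Unit) :=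
  SimpleGraph.fromRel fun x y =>
    match x, y with
    | Sum.inl a, Sum.inl b => G.Adj ↑a ↑b
    | Sum.inl a, Sum.inr _ => ∃ r ∈ R, G.Adj ↑a r
    | _, _ => False

/-- `v` is a cutvertex of `H` : deleting `v` leaves a disconnected
(non-preconnected) graph. -/
def IsCutvertex (H : SimpleGraph W) (v : W) : Prop :=
  ¬ (H.induce ({v}ᶜ : Set W)).Preconnected

/-- `B` is a block of `H` : a maximal connected subgraph having no cutvertex of
its own. -/
def IsBlock (H : SimpleGraph W) (B : H.Subgraph) : Prop :=
  B.coe.Connected ∧ (∀ v, ¬ IsCutvertex B.coe v) ∧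
    ∀ B' : H.Subgraph, B ≤ B' → B'.coe.Connected →
      (∀ v, ¬ IsCutvertex B'.coe v) → B' = B

/-- `H` is a cycle of even length. -/
def IsEvenCycleGraph (H : SimpleGraph W) : Prop :=
  ∃ n : ℕ, Even n ∧ 3 ≤ n ∧ Nonempty (H ≃g SimpleGraph.cycleGraph n)

/-- `H` is a single edge. -/
def IsSingleEdgeGraph (H : SimpleGraph W) : Prop :=
  ∃ u v : W, u ≠ v ∧ H.Adj u v ∧ ∀ w : W, w = u ∨ w = v

/-- `H` is a simple block EP (SBEP) graph: a connected graph in which every block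
is an even cycle or a single edge, and every vertex lies in at most two blocks. -/
def IsSBEP (H : SimpleGraph W) : Prop :=
  H.Connected ∧
    (∀ B : H.Subgraph, IsBlock H B → IsEvenCycleGraph B.coe ∨ IsSingleEdgeGraph B.coe) ∧
    ∀ (v : W) (B₁ B₂ B₃ : H.Subgraph),
      IsBlock H B₁ ∧ v ∈ B₁.verts → IsBlock H B₂ ∧ v ∈ B₂.verts →
      IsBlock H B₃ ∧ v ∈ B₃.verts → B₁ = B₂ ∨ B₁ = B₃ ∨ B₂ = B₃

/-- `v` is a single-block vertex of `H` : it lies in exactly one block. -/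
def SingleBlockVertex (H : SimpleGraph W) (v : W) : Prop :=
  ∃! B : H.Subgraph, IsBlock H B ∧ v ∈ B.verts

/-- A set of vertices properly contained in a set inducing a connected subgraph sends an edge
to the rest of that set. -/
lemma SimpleGraph.Preconnected.exists_adj_of_subset_of_ne {G : SimpleGraph V} {R R' : Set V}
    (hR' : (G.induce R').Preconnected) (hR : R.Nonempty) (hsub : R ⊆ R') (hne : R' ≠ R) :
    ∃ a ∈ R, ∃ b ∈ R', b ∉ R ∧ G.Adj a b := by
  obtain ⟨x, hx⟩ := hR
  obtain ⟨y, hy, hyR⟩ : ∃ y ∈ R', y ∉ R := by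
    by_contra! h
    exact hne (Set.Subset.antisymm h hsub)
  obtain ⟨p⟩ := hR' ⟨x, hsub hx⟩ ⟨y, hy⟩
  obtain ⟨d, -, hd₁, hd₂⟩ := p.exists_boundary_dart (Subtype.val ⁻¹' R) hx hyR
  exact ⟨d.fst, hd₁, d.snd, d.snd.2, hd₂, d.adj⟩

lemma IsCompOf.nonempty {G : SimpleGraph V} {S R : Set V} (h : IsCompOf G S R) : R.Nonempty :=
  Set.nonempty_coe_sort.mp h.2.1.nonempty

/-- A neighbor of a component of `G - S` lies in the component or in `S`. -/
lemma IsCompOf.mem_of_adj {G : SimpleGraph V} {S R : Set V} (h : IsCompOf G S R) {a b : V}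
    (ha : a ∈ R) (hab : G.Adj a b) (hb : b ∉ S) : b ∈ R := by
  have hb' : (G.induce ({b} : Set V)).Preconnected := by
    rw [induce_singleton_eq_top]
    exact preconnected_top
  rw [← h.2.2 (R ∪ {b}) Set.subset_union_left
    (Set.union_subset h.1 (Set.singleton_subset_iff.mpr hb))
    (connected_induce_union h.2.1.preconnected hb' ha rfl hab)]
  exact Or.inr rfl

/-- A component of `G - S` not adjacent to a set is still a component when that set is returned. -/
lemma IsCompOf.sdiff {G : SimpleGraph V} {S S' R : Set V} (h : IsCompOf G S R)
    (hadj : ¬ ∃ u ∈ S', AdjToSet G u R) : IsCompOf G (S \ S') R := by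
  refine ⟨fun x hx hxS => h.1 hx hxS.1, h.2.1, fun R' hsub hR'S hR' => ?_⟩
  by_contra hne
  obtain ⟨a, ha, b, hb, hbR, hab⟩ :=
    hR'.preconnected.exists_adj_of_subset_of_ne h.nonempty hsub hne
  by_cases hbS : b ∈ S
  · have hbS' : b ∈ S' := by
      by_contra hbS'
      exact hR'S hb ⟨hbS, hbS'⟩
    exact hadj ⟨b, hbS', a, ha, hab.symm⟩
  · exact hbR (h.mem_of_adj ha hab hbS)

/-- In a finite graph, every vertex outside `S` lies in a component of `G - S`. -/
lemma exists_isCompOf_mem [Finite V] (G : SimpleGraph V) {S : Set V} {v : V} (hv : v ∉ S) :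
    ∃ R, IsCompOf G S R ∧ v ∈ R := by
  have hv' : ({v} : Set V) ⊆ Sᶜ ∧ (G.induce ({v} : Set V)).Connected := by
    refine ⟨Set.singleton_subset_iff.mpr hv, ?_⟩
    rw [induce_singleton_eq_top]
    exact connected_top
  obtain ⟨R, hvR, hR⟩ := Finite.exists_le_maximal
    (p := fun R : Set V => R ⊆ Sᶜ ∧ (G.induce R).Connected) hv'
  exact ⟨R, ⟨hR.prop.1, hR.prop.2, fun R' hsub h₁ h₂ =>
    (hR.eq_of_subset ⟨h₁, h₂⟩ hsub).symm⟩, hvR rfl⟩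

/-- Returning a nonempty subset of `S` to `G - S` merges only the components adjacent to it,
and leaves at least one component meeting it. -/
lemma numComp_add_one_le [Finite V] (G : SimpleGraph V) {S S' : Set V} (hsub : S' ⊆ S)
    (hne : S'.Nonempty) :
    numComp G S + 1 ≤ numComp G (S \ S') +
      {R : Set V | IsCompOf G S R ∧ ∃ u ∈ S', AdjToSet G u R}.ncard := by
  obtain ⟨u, hu⟩ := hne
  obtain ⟨C, hC, huC⟩ := exists_isCompOf_mem G (S := S \ S') (v := u) (fun h => h.2 hu)
  set A := {R : Set V | IsCompOf G S R ∧ ∃ u ∈ S', AdjToSet G u R}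
  set B := {R : Set V | IsCompOf G S R}
  have hAB : (B \ A).ncard + A.ncard = B.ncard :=
    Set.ncard_sdiff_add_ncard_of_subset fun R hR => hR.1
  have hCB : C ∉ B \ A := fun h => h.1.1 huC (hsub hu)
  have hle : (insert C (B \ A)).ncard ≤ numComp G (S \ S') := by
    refine Set.ncard_le_ncard (Set.insert_subset hC fun R hR => ?_)
    exact IsCompOf.sdiff hR.1 fun h => hR.2 ⟨hR.1, h⟩
  rw [Set.ncard_insert_of_notMem hCB] at hle
  change B.ncard + 1 ≤ _
  omega

/-- If `τ(G) = t ≤ 1` and `S` is a tough-set of `G`, then every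
nonempty subset `S'` of `S` is adjacent to at least `|S'|/t` components of `G - S`. -/
theorem stmt_13 {V : Type*} [Fintype V] (G : SimpleGraph V) (t : ℝ)
    (hconn : G.Connected) (htough : IsToughness G t) (ht : t ≤ 1)
    (S : Set V) (hS : ToughSet G t S) (S' : Set V) (hsub : S' ⊆ S)
    (hne : S'.Nonempty) :
    (S'.ncard : ℝ) / t ≤
      ({R : Set V | IsCompOf G S R ∧ ∃ u ∈ S', AdjToSet G u R}.ncard : ℝ) := by
  obtain ⟨hcut, hcard⟩ := hS
  have hcount := numComp_add_one_le G hsub hne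
  set k := {R : Set V | IsCompOf G S R ∧ ∃ u ∈ S', AdjToSet G u R}.ncard
  have hc : (0 : ℝ) < numComp G S := by
    have : 0 < numComp G S := lt_of_lt_of_le two_pos hcut
    exact_mod_cast this
  have ht₀ : 0 ≤ t := nonneg_of_mul_nonneg_left (hcard ▸ Nat.cast_nonneg _) hc
  rcases ht₀.eq_or_lt with rfl | ht₀
  · simp
  rw [div_le_iff₀ ht₀, mul_comm]
  by_cases hk : numComp G S ≤ k
  · calc (S'.ncard : ℝ) ≤ S.ncard := by exact_mod_cast Set.ncard_le_ncard hsub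
      _ = t * numComp G S := hcard
      _ ≤ t * k := by gcongr
  · have hT := htough.1 (S \ S') (show 2 ≤ numComp G (S \ S') by omega)
    have hS : ((S \ S').ncard : ℝ) + S'.ncard = S.ncard := by
      exact_mod_cast Set.ncard_sdiff_add_ncard_of_subset hsub
    have hle : (numComp G S : ℝ) ≤ numComp G (S \ S') + k := by
      exact_mod_cast (Nat.le_succ _).trans hcount
    nlinarith
end

section
/- Let G be a complete bipartite graph with parts X and Y satisfying |X| ≤ |Y| ≤ 2|X|. Then G has a spanning SBEP subgraph in which every vertex of Y is a single-block vertex. -/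
open SimpleGraph

variable {V : Type*} {W : Type*}

/-- `H` is connected and has no cutvertex. -/
def Nonseparable (H : SimpleGraph W) : Prop := H.Connected ∧ ∀ v, ¬ IsCutvertex H v

lemma Nonseparable.of_iso {H : SimpleGraph V} {H' : SimpleGraph W} (φ : H ≃g H')
    (h : Nonseparable H) : Nonseparable H' := by
  refine ⟨φ.connected_iff.1 h.1, fun w hw => h.2 (φ.symm w) fun hp => hw ?_⟩
  let g : H.induce ({φ.symm w}ᶜ : Set V) →g H'.induce ({w}ᶜ : Set W) :=
    { toFun := fun a => ⟨φ a.1, fun ha => a.2 (by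
        rw [Set.mem_singleton_iff] at ha ⊢
        exact φ.injective (ha.trans (φ.apply_symm_apply w).symm))⟩
      map_rel' := fun {a b} hab => φ.map_rel_iff.2 hab }
  refine Preconnected.map g (fun b => ?_) hp
  refine ⟨⟨φ.symm b.1, fun hb => b.2 (φ.symm.injective hb)⟩, ?_⟩
  exact Subtype.ext (φ.apply_symm_apply b.1)

lemma IsSingleEdgeGraph.nonseparable {H : SimpleGraph W} (h : IsSingleEdgeGraph H) :
    Nonseparable H := by
  obtain ⟨u, v, huv, hadj, hall⟩ := h
  have : Nonempty W := ⟨u⟩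
  refine ⟨⟨fun a b => ?_⟩, fun w hw => hw fun a b => ?_⟩
  · rcases hall a with rfl | rfl <;> rcases hall b with rfl | rfl
    exacts [Reachable.refl _, hadj.reachable, hadj.symm.reachable, Reachable.refl _]
  · have hab : a = b := by
      apply Subtype.ext
      have ha : a.1 ≠ w := a.2
      have hb : b.1 ≠ w := b.2
      have ha' := hall a.1
      have hb' := hall b.1
      have hw' := hall w
      grind
    rw [hab]

lemma cycleGraph_nonseparable (n : ℕ) : Nonseparable (cycleGraph (n + 1)) := by
  refine ⟨cycleGraph_connected, fun v hv => hv ?_⟩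
  have hlt (i : ℕ) : (v.1 + 1 + i) % (n + 1) < n + 1 := Nat.mod_lt _ n.succ_pos
  have hne (i : ℕ) (hi : i < n) : (⟨(v.1 + 1 + i) % (n + 1), hlt i⟩ : Fin (n + 1)) ≠ v := by
    intro h
    have h1 := congrArg Fin.val h
    have h2 := v.2
    simp only at h1
    rcases lt_or_ge (v.1 + 1 + i) (n + 1) with h3 | h3
    · rw [Nat.mod_eq_of_lt h3] at h1; omega
    · rw [Nat.mod_eq_sub_mod h3, Nat.mod_eq_of_lt (by omega)] at h1; omega
  have key (i : ℕ) (hi : i < n) (h0 : 0 < n) :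
      ((cycleGraph (n + 1)).induce ({v}ᶜ : Set (Fin (n + 1)))).Reachable
        ⟨_, hne 0 h0⟩ ⟨_, hne i hi⟩ := by
    induction i with
    | zero => exact Reachable.refl _
    | succ i ih =>
      refine (ih (by omega)).trans (Adj.reachable ?_)
      rw [comap_adj]
      obtain ⟨k, rfl⟩ : ∃ k, n = k + 1 := ⟨n - 1, by omega⟩
      refine cycleGraph_adj.2 (Or.inr ?_)
      apply sub_eq_of_eq_add
      apply Fin.ext
      simp [Fin.val_add]
      ring_nf
  have hsurj (a : ({v}ᶜ : Set (Fin (n + 1)))) : ∃ i, ∃ hi : i < n, a = ⟨_, hne i hi⟩ := by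
    obtain ⟨a, ha⟩ := a
    have h1 : a.1 ≠ v.1 := fun h => ha (Fin.ext h)
    have h2 := a.2
    have h3 := v.2
    rcases lt_or_gt_of_ne h1 with h | h
    · refine ⟨a.1 + n - v.1, by omega, Subtype.ext (Fin.ext ?_)⟩
      have : v.1 + 1 + (a.1 + n - v.1) = a.1 + (n + 1) := by omega
      simp [this, Nat.mod_eq_of_lt h2]
    · refine ⟨a.1 - v.1 - 1, by omega, Subtype.ext (Fin.ext ?_)⟩
      have : v.1 + 1 + (a.1 - v.1 - 1) = a.1 := by omega
      simp [this, Nat.mod_eq_of_lt h2]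
  intro a b
  obtain ⟨i, hi, rfl⟩ := hsurj a
  obtain ⟨j, hj, rfl⟩ := hsurj b
  exact (key i hi (by omega)).symm.trans (key j hj (by omega))

lemma le_induce_top_iff {H : SimpleGraph V} {B : H.Subgraph} {s : Set V} :
    B ≤ (⊤ : H.Subgraph).induce s ↔ B.verts ⊆ s :=
  ⟨fun h => h.1, fun h => Subgraph.le_induce_top_verts.trans (Subgraph.induce_mono_right h)⟩

lemma exists_adj_of_preconnected {H : SimpleGraph V} (h : H.Preconnected) {a b : V}
    (hab : a ≠ b) : ∃ c, H.Adj a c :=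
  have : Nontrivial V := ⟨a, b, hab⟩
  h.exists_adj_of_nontrivial a

/-- `H` arises from its induced subgraph on `K`, which is nonseparable and nontrivial, by attaching
to each vertex of an injective family of vertices of `K` a pendant vertex;
`f` sends a pendant vertex to its neighbor. -/
structure IsPendantExtension (H : SimpleGraph V) (K : Set V) (f : V → V) : Prop where
  adj_iff : ∀ p ∉ K, ∀ w, H.Adj p w ↔ w = f p
  mapsTo : ∀ p ∉ K, f p ∈ K
  injOn : Set.InjOn f Kᶜ
  nonseparable : Nonseparable (H.induce K)
  nontrivial : K.Nontrivial

namespace IsPendantExtension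

variable {H : SimpleGraph V} {K : Set V} {f : V → V}

lemma ne_apply (h : IsPendantExtension H K f) {p : V} (hp : p ∉ K) : p ≠ f p :=
  fun e => hp (e ▸ h.mapsTo p hp)

lemma isSingleEdgeGraph (h : IsPendantExtension H K f) {p : V} (hp : p ∉ K) :
    IsSingleEdgeGraph (H.induce {p, f p}) := by
  refine ⟨⟨p, by simp⟩, ⟨f p, by simp⟩, fun e => h.ne_apply hp (congrArg Subtype.val e), ?_, ?_⟩
  · exact (h.adj_iff p hp _).2 rfl
  · rintro ⟨w, rfl | rfl⟩ <;> simp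

/-- A nonseparable subgraph containing a pendant vertex lies in the corresponding pendant edge. -/
lemma verts_subset_pair (h : IsPendantExtension H K f) {B : H.Subgraph}
    (hB : Nonseparable B.coe) {p : V} (hp : p ∉ K) (hpB : p ∈ B.verts) :
    B.verts ⊆ {p, f p} := by
  intro z hz
  by_contra hzp
  simp only [Set.mem_insert_iff, Set.mem_singleton_iff, not_or] at hzp
  obtain ⟨c, hc⟩ := exists_adj_of_preconnected hB.1.preconnected
    (a := ⟨p, hpB⟩) (b := ⟨z, hz⟩) (fun e => hzp.1 (congrArg Subtype.val e).symm)
  have hcf : c.1 = f p := (h.adj_iff p hp _).1 (B.adj_sub hc)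
  obtain ⟨d, hd⟩ := exists_adj_of_preconnected (not_not.1 (hB.2 c))
    (a := ⟨⟨p, hpB⟩, fun e => h.ne_apply hp ((congrArg Subtype.val e).trans hcf)⟩)
    (b := ⟨⟨z, hz⟩, fun e => hzp.2 ((congrArg Subtype.val e).trans hcf)⟩)
    (fun e => hzp.1 (congrArg (fun x => x.1.1) e).symm)
  exact d.2 (Subtype.ext (((h.adj_iff p hp _).1 (B.adj_sub hd)).trans hcf.symm))

lemma verts_subset (h : IsPendantExtension H K f) {B : H.Subgraph} (hB : Nonseparable B.coe) :
    B.verts ⊆ K ∨ ∃ p ∉ K, p ∈ B.verts ∧ B.verts ⊆ {p, f p} := by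
  by_cases hK : B.verts ⊆ K
  · exact Or.inl hK
  · obtain ⟨p, hpB, hp⟩ := Set.not_subset.1 hK
    exact Or.inr ⟨p, hp, hpB, h.verts_subset_pair hB hp hpB⟩

lemma isBlock_induce (h : IsPendantExtension H K f) : IsBlock H ((⊤ : H.Subgraph).induce K) := by
  have hn := h.nonseparable
  rw [induce_eq_coe_induce_top] at hn
  refine ⟨hn.1, hn.2, fun B hle hc hv => ?_⟩
  refine le_antisymm (le_induce_top_iff.2 ?_) hle
  rcases h.verts_subset ⟨hc, hv⟩ with hs | ⟨p, hp, -, hs⟩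
  · exact hs
  · obtain ⟨a, ha, b, hb, hab⟩ := h.nontrivial
    have eq_of_mem {c : V} (hcK : c ∈ K) : c = f p := by
      rcases hs (hle.1 hcK) with rfl | e
      exacts [absurd hcK hp, e]
    exact absurd ((eq_of_mem ha).trans (eq_of_mem hb).symm) hab

lemma isBlock_pair (h : IsPendantExtension H K f) {p : V} (hp : p ∉ K) :
    IsBlock H ((⊤ : H.Subgraph).induce {p, f p}) := by
  have hn := (h.isSingleEdgeGraph hp).nonseparable
  rw [induce_eq_coe_induce_top] at hn
  refine ⟨hn.1, hn.2, fun B hle hc hv => le_antisymm (le_induce_top_iff.2 ?_) hle⟩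
  exact h.verts_subset_pair ⟨hc, hv⟩ hp (hle.1 (Set.mem_insert _ _))

lemma isBlock_iff (h : IsPendantExtension H K f) {B : H.Subgraph} :
    IsBlock H B ↔ B = (⊤ : H.Subgraph).induce K ∨
      ∃ p ∉ K, B = (⊤ : H.Subgraph).induce {p, f p} := by
  constructor
  · rintro ⟨hc, hv, hmax⟩
    rcases h.verts_subset ⟨hc, hv⟩ with hs | ⟨p, hp, -, hs⟩
    · have hb := h.isBlock_induce
      exact Or.inl (hmax _ (le_induce_top_iff.2 hs) hb.1 hb.2.1).symm
    · have hb := h.isBlock_pair hp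
      exact Or.inr ⟨p, hp, (hmax _ (le_induce_top_iff.2 hs) hb.1 hb.2.1).symm⟩
  · rintro (rfl | ⟨p, hp, rfl⟩)
    exacts [h.isBlock_induce, h.isBlock_pair hp]

lemma connected (h : IsPendantExtension H K f) : H.Connected := by
  obtain ⟨a, ha⟩ := h.nontrivial.nonempty
  have hK (b : V) (hb : b ∈ K) : H.Reachable b a :=
    (h.nonseparable.1.preconnected ⟨b, hb⟩ ⟨a, ha⟩).map (Embedding.induce K).toHom
  have hall (b : V) : H.Reachable b a := by
    by_cases hb : b ∈ K
    · exact hK b hb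
    · exact (Adj.reachable ((h.adj_iff b hb _).2 rfl)).trans (hK _ (h.mapsTo b hb))
  have : Nonempty V := ⟨a⟩
  exact ⟨fun b c => (hall b).trans (hall c).symm⟩

lemma eq_or_eq_of_mem_pair (h : IsPendantExtension H K f) {v p q : V} (hp : p ∉ K) (hq : q ∉ K)
    (hvp : v ∈ ({p, f p} : Set V)) (hvq : v ∈ ({q, f q} : Set V)) : p = q := by
  rcases hvp with rfl | hvp <;> rcases hvq with hvq | hvq
  · exact hvq
  · exact absurd (hvq ▸ h.mapsTo q hq) hp
  · subst hvq
    exact absurd (hvp ▸ h.mapsTo p hp) hq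
  · exact h.injOn hp hq (hvp.symm.trans hvq)

lemma isSBEP (h : IsPendantExtension H K f)
    (hK : IsEvenCycleGraph (H.induce K) ∨ IsSingleEdgeGraph (H.induce K)) : IsSBEP H := by
  refine ⟨h.connected, fun B hB => ?_, ?_⟩
  · rcases h.isBlock_iff.1 hB with rfl | ⟨p, hp, rfl⟩
    · rwa [induce_eq_coe_induce_top] at hK
    · have hp' := h.isSingleEdgeGraph hp
      rw [induce_eq_coe_induce_top] at hp'
      exact Or.inr hp'
  · rintro v B₁ B₂ B₃ ⟨h₁, hv₁⟩ ⟨h₂, hv₂⟩ ⟨h₃, hv₃⟩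
    rcases h.isBlock_iff.1 h₁ with e₁ | ⟨p₁, hp₁, e₁⟩ <;>
    rcases h.isBlock_iff.1 h₂ with e₂ | ⟨p₂, hp₂, e₂⟩ <;>
    rcases h.isBlock_iff.1 h₃ with e₃ | ⟨p₃, hp₃, e₃⟩ <;> subst e₁ e₂ e₃
    · exact Or.inl rfl
    · exact Or.inl rfl
    · exact Or.inr (Or.inl rfl)
    · exact Or.inr (Or.inr (by rw [h.eq_or_eq_of_mem_pair hp₂ hp₃ hv₂ hv₃]))
    · exact Or.inr (Or.inr rfl)
    · exact Or.inr (Or.inl (by rw [h.eq_or_eq_of_mem_pair hp₁ hp₃ hv₁ hv₃]))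
    · exact Or.inl (by rw [h.eq_or_eq_of_mem_pair hp₁ hp₂ hv₁ hv₂])
    · exact Or.inl (by rw [h.eq_or_eq_of_mem_pair hp₁ hp₂ hv₁ hv₂])

lemma singleBlockVertex (h : IsPendantExtension H K f) {v : V} (hv : v ∉ f '' Kᶜ) :
    SingleBlockVertex H v := by
  by_cases hvK : v ∈ K
  · refine ⟨_, ⟨h.isBlock_induce, hvK⟩, ?_⟩
    rintro B ⟨hB, hvB⟩
    rcases h.isBlock_iff.1 hB with rfl | ⟨p, hp, rfl⟩
    · rfl
    · rcases hvB with rfl | e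
      exacts [absurd hvK hp, absurd ⟨p, hp, e.symm⟩ hv]
  · refine ⟨_, ⟨h.isBlock_pair hvK, Set.mem_insert _ _⟩, ?_⟩
    rintro B ⟨hB, hvB⟩
    rcases h.isBlock_iff.1 hB with rfl | ⟨p, hp, rfl⟩
    · exact absurd hvB hvK
    · rw [h.eq_or_eq_of_mem_pair hp hvK hvB (Set.mem_insert _ _)]

end IsPendantExtension

/-- The graph obtained from the image of `C` under `e` by joining each vertex `p` outside that image
to `f p`. -/
def attachPendants (C : SimpleGraph W) (e : W ↪ V) (f : V → V) : SimpleGraph V :=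
  C.map e ⊔ SimpleGraph.fromRel fun a b => a ∉ Set.range e ∧ b = f a

section attachPendants

variable {C : SimpleGraph W} {e : W ↪ V} {f : V → V}

lemma attachPendants_adj_apply (i j : W) :
    (attachPendants C e f).Adj (e i) (e j) ↔ C.Adj i j := by
  simp [attachPendants]

/-- The copy of `C` inside `attachPendants C e f` is induced. -/
noncomputable def isoInduceAttachPendants :
    C ≃g (attachPendants C e f).induce (Set.range e) where
  toEquiv := Equiv.ofInjective e e.injective
  map_rel_iff' := fun {i j} => attachPendants_adj_apply i j

lemma attachPendants_isPendantExtension [Nontrivial W] (hC : Nonseparable C)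
    (hf : ∀ p ∉ Set.range e, f p ∈ Set.range e) (hinj : Set.InjOn f (Set.range e)ᶜ) :
    IsPendantExtension (attachPendants C e f) (Set.range e) f where
  adj_iff p hp w := by
    simp only [attachPendants, sup_adj, fromRel_adj]
    constructor
    · rintro (hm | ⟨-, ⟨-, rfl⟩ | ⟨hw, rfl⟩⟩)
      · obtain ⟨i, j, -, rfl, -⟩ := (SimpleGraph.map_adj _ _ _ _).1 hm
        exact absurd ⟨i, rfl⟩ hp
      · rfl
      · exact absurd (hf w hw) hp
    · rintro rfl
      exact Or.inr ⟨fun h => hp (h ▸ hf p hp), Or.inl ⟨hp, rfl⟩⟩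
  mapsTo := hf
  injOn := hinj
  nonseparable := hC.of_iso isoInduceAttachPendants
  nontrivial := by
    obtain ⟨i, j, hij⟩ := exists_pair_ne W
    exact ⟨e i, ⟨i, rfl⟩, e j, ⟨j, rfl⟩, e.injective.ne hij⟩

end attachPendants

lemma cycleGraph_even_adj_mod {m : ℕ} {i j : Fin (2 * m)} (h : (cycleGraph (2 * m)).Adj i j) :
    i.1 % 2 ≠ j.1 % 2 := by
  intro hij
  have hi := i.2
  have hj := j.2
  rcases cycleGraph_adj'.1 h with h | h <;> rw [Fin.sub_def] at h <;> simp only at h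
  · rcases lt_or_ge (2 * m - j.1 + i.1) (2 * m) with h3 | h3
    · rw [Nat.mod_eq_of_lt h3] at h; omega
    · rw [Nat.mod_eq_sub_mod h3, Nat.mod_eq_of_lt (by omega)] at h; omega
  · rcases lt_or_ge (2 * m - i.1 + j.1) (2 * m) with h3 | h3
    · rw [Nat.mod_eq_of_lt h3] at h; omega
    · rw [Nat.mod_eq_sub_mod h3, Nat.mod_eq_of_lt (by omega)] at h; omega

/-- Two disjoint sets with `m` elements each can be enumerated alternately. -/
lemma exists_alternating_embedding [Finite V] {X Y : Set V} {m : ℕ} (hdisj : Disjoint X Y)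
    (hX : X.ncard = m) (hY : Y.ncard = m) :
    ∃ e : Fin (2 * m) ↪ V, Set.range e = X ∪ Y ∧ ∀ i, (i.1 % 2 = 0 → e i ∈ X) ∧
      (i.1 % 2 ≠ 0 → e i ∈ Y) := by
  let x : X ≃ Fin m := Finite.equivFinOfCardEq hX
  let y : Y ≃ Fin m := Finite.equivFinOfCardEq hY
  let e (i : Fin (2 * m)) : V :=
    if i.1 % 2 = 0 then (x.symm ⟨i.1 / 2, by omega⟩).1 else (y.symm ⟨i.1 / 2, by omega⟩).1
  have hmem (i : Fin (2 * m)) : (i.1 % 2 = 0 → e i ∈ X) ∧ (i.1 % 2 ≠ 0 → e i ∈ Y) := by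
    constructor <;> intro hi <;> simp [e, hi]
  have hinj : Function.Injective e := by
    intro i j hij
    have hne {a b : V} (ha : a ∈ X) (hb : b ∈ Y) : a ≠ b := hdisj.ne_of_mem ha hb
    by_cases hi : i.1 % 2 = 0 <;> by_cases hj : j.1 % 2 = 0
    · simp only [e, hi, hj, if_true] at hij
      have := congrArg Fin.val (x.symm.injective (Subtype.ext hij))
      simp only at this
      exact Fin.ext (by omega)
    · exact absurd hij (hne ((hmem i).1 hi) ((hmem j).2 hj))
    · exact absurd hij.symm (hne ((hmem j).1 hj) ((hmem i).2 hi))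
    · simp only [e, hi, hj, if_false] at hij
      have := congrArg Fin.val (y.symm.injective (Subtype.ext hij))
      simp only at this
      exact Fin.ext (by omega)
  refine ⟨⟨e, hinj⟩, ?_, hmem⟩
  ext v
  constructor
  · rintro ⟨i, rfl⟩
    by_cases hi : i.1 % 2 = 0
    exacts [Or.inl ((hmem i).1 hi), Or.inr ((hmem i).2 hi)]
  · rintro (hv | hv)
    · refine ⟨⟨2 * (x ⟨v, hv⟩).1, by omega⟩, ?_⟩
      simp [e]
    · refine ⟨⟨2 * (y ⟨v, hv⟩).1 + 1, by omega⟩, ?_⟩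
      have : (2 * (y ⟨v, hv⟩).1 + 1) / 2 = (y ⟨v, hv⟩).1 := by omega
      simp [e, this, Nat.add_mod]

lemma cycleGraph_even_isEvenCycleGraph_or {H : SimpleGraph W} {m : ℕ} (hm : 0 < m)
    (φ : cycleGraph (2 * m) ≃g H) : IsEvenCycleGraph H ∨ IsSingleEdgeGraph H := by
  obtain rfl | hm : m = 1 ∨ 2 ≤ m := by omega
  · refine Or.inr ⟨φ 0, φ 1, φ.injective.ne (by decide), φ.map_rel_iff.2 ?_, fun w => ?_⟩
    · exact cycleGraph_adj.2 (by decide)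
    · obtain ⟨i, rfl⟩ := φ.surjective w
      have : i = 0 ∨ i = 1 := by fin_cases i <;> simp
      rcases this with rfl | rfl <;> simp
  · exact Or.inl ⟨2 * m, even_two_mul m, by omega, ⟨φ.symm⟩⟩

/-- A complete bipartite graph with parts `X`, `Y` satisfying
`|X| ≤ |Y| ≤ 2|X|` has a spanning SBEP subgraph in which every vertex of `Y` is a
single-block vertex. -/
theorem stmt_17 {V : Type*} [Fintype V] [Nonempty V] (G : SimpleGraph V)
    (X Y : Set V) (hdisj : Disjoint X Y) (hunion : X ∪ Y = Set.univ)
    (hadj : ∀ u v : V, G.Adj u v ↔ (u ∈ X ∧ v ∈ Y) ∨ (u ∈ Y ∧ v ∈ X))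
    (hXY : X.ncard ≤ Y.ncard) (hYX : Y.ncard ≤ 2 * X.ncard) :
    ∃ H : SimpleGraph V, H ≤ G ∧ IsSBEP H ∧ ∀ y ∈ Y, SingleBlockVertex H y := by
  have hX0 : 0 < X.ncard := by
    by_contra h0
    have hX : X = ∅ := (Set.ncard_eq_zero).1 (by omega)
    have hY : Y = ∅ := (Set.ncard_eq_zero).1 (by omega)
    rw [hX, hY, Set.union_empty] at hunion
    exact Set.empty_ne_univ hunion
  obtain ⟨Y', hY'Y, hY'⟩ := Set.exists_subset_card_eq hXY
  obtain ⟨e, hrange, he⟩ :=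
    exists_alternating_embedding (hdisj.mono_right hY'Y) rfl hY'
  have hcompl {p : V} (hp : p ∉ Set.range e) : p ∈ Y \ Y' := by
    rw [hrange, Set.mem_union, not_or] at hp
    have := hunion.ge (Set.mem_univ p)
    exact ⟨this.resolve_left hp.1, hp.2⟩
  have hcard : (Y \ Y').encard ≤ X.encard := by
    rw [← (Set.toFinite _).cast_ncard_eq, ← (Set.toFinite _).cast_ncard_eq,
      Set.ncard_sdiff hY'Y]
    exact_mod_cast (by omega)
  obtain ⟨f, hfX, hfinj⟩ := (Set.toFinite (Y \ Y')).exists_injOn_of_encard_le hcard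
  have hfmem {p : V} (hp : p ∉ Set.range e) : f p ∈ X := hfX (hcompl hp)
  obtain ⟨k, hk⟩ : ∃ k, 2 * X.ncard = k + 1 := ⟨2 * X.ncard - 1, by omega⟩
  have hC : Nonseparable (cycleGraph (2 * X.ncard)) := hk ▸ cycleGraph_nonseparable k
  have : Nontrivial (Fin (2 * X.ncard)) := Fin.nontrivial_iff_two_le.2 (by omega)
  have hH := attachPendants_isPendantExtension hC (e := e) (f := f)
    (fun p hp => hrange ▸ Or.inl (hfmem hp)) (hfinj.mono fun p hp => hcompl hp)
  refine ⟨_, ?_, hH.isSBEP (cycleGraph_even_isEvenCycleGraph_or hX0 isoInduceAttachPendants),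
    fun y hy => hH.singleBlockVertex ?_⟩
  · refine sup_le (fun a b hab => ?_) (fun a b hab => ?_)
    · obtain ⟨i, j, hij, rfl, rfl⟩ := (SimpleGraph.map_adj _ _ _ _).1 hab
      have hmod := cycleGraph_even_adj_mod hij
      by_cases hi : i.1 % 2 = 0
      · exact (hadj _ _).2 (Or.inl ⟨(he i).1 hi, hY'Y ((he j).2 (by omega))⟩)
      · exact (hadj _ _).2 (Or.inr ⟨hY'Y ((he i).2 hi), (he j).1 (by omega)⟩)
    · rcases hab with ⟨-, ⟨ha, rfl⟩ | ⟨hb, rfl⟩⟩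
      · exact (hadj _ _).2 (Or.inr ⟨(hcompl ha).1, hfmem ha⟩)
      · exact (hadj _ _).2 (Or.inl ⟨hfmem hb, (hcompl hb).1⟩)
  · rintro ⟨p, hp, rfl⟩
    exact hdisj.ne_of_mem (hfmem hp) hy rfl
end
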